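/- Fix an integer d ≥ 1 and M ∈ (0,1]. Let a⁽¹⁾, …, a⁽ᵈ⁾ : ℝ^d → ℝ^d be C² vector fields with ‖a⁽ⁱ⁾‖_{C²_b} := Σ_{|γ|≤2} ‖∂^γ a⁽ⁱ⁾‖_{L^∞} ≤ M, let Φ⁽ⁱ⁾ : ℝ × ℝ^d → ℝ^d denote the (globally defined) flow of a⁽ⁱ⁾ (Φ⁽ⁱ⁾_0 = id, (d/dt)Φ⁽ⁱ⁾_t(x) = a⁽ⁱ⁾(Φ⁽ⁱ⁾_t(x))), fix x₀ ∈ ℝ^d, and for 𝐭 = (t₁,…,t_d) ∈ ℝ^d set H(𝐭) := Φ⁽ᵈ⁾_{t_d} ∘ ⋯ ∘ Φ⁽¹⁾_{t₁}(x₀). Then H is of class C² and for every 𝐭 ∈ ℝ^d one has ‖dH(𝐭)‖ ≤ 2^{d+1} e^{M|𝐭|_{ℓ¹}} and ‖d²H(𝐭)‖ ≤ 2^{2d+2} e^{2M|𝐭|_{ℓ¹}}, where |𝐭|_{ℓ¹} = |t₁| + ⋯ + |t_d|. -/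

import Mathlib

open MeasureTheory Real

/-- `Hmap Φ x₀ i 𝐭 = Φ⁽ⁱ⁾_{t_i} ∘ ⋯ ∘ Φ⁽¹⁾_{t₁} (x₀)`, the point reached after following
the first `i` flows during the times prescribed by `𝐭`. -/
noncomputable def Hmap {d : ℕ}
    (Φ : Fin d → ℝ → EuclideanSpace ℝ (Fin d) → EuclideanSpace ℝ (Fin d))
    (x₀ : EuclideanSpace ℝ (Fin d)) (i : ℕ) (t : EuclideanSpace ℝ (Fin d)) :
    EuclideanSpace ℝ (Fin d) :=
  (List.range i).foldl (fun x k => if h : k < d then Φ ⟨k, h⟩ (t ⟨k, h⟩) x else x) x₀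

open Set Filter Topology

/-- A map that is continuous in the second variable, and Lipschitz in the first one locally
uniformly, is jointly continuous. -/
theorem continuous_uncurry_of_lipschitz_left {X F : Type*} [TopologicalSpace X]
    [NormedAddCommGroup F] {f : ℝ → X → F} {C : ℝ → ℝ} (hf : ∀ s, Continuous (f s))
    (hC : ∀ R s r x, |s| ≤ R → |r| ≤ R → ‖f s x - f r x‖ ≤ C R * |s - r|) :
    Continuous fun p : ℝ × X => f p.1 p.2 := by
  rw [continuous_iff_continuousAt]
  rintro ⟨s, x⟩
  have h1 : Tendsto (fun p : ℝ × X => f s p.2) (𝓝 (s, x)) (𝓝 (f s x)) :=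
    ((hf s).comp continuous_snd).tendsto (s, x)
  have h2 : Tendsto (fun p : ℝ × X => f p.1 p.2 - f s p.2) (𝓝 (s, x)) (𝓝 0) := by
    have hc : Continuous fun p : ℝ × X => C (|s| + 1) * |p.1 - s| := by fun_prop
    have hlim : Tendsto (fun p : ℝ × X => C (|s| + 1) * |p.1 - s|) (𝓝 (s, x)) (𝓝 0) := by
      simpa using hc.tendsto (s, x)
    have hev : ∀ᶠ p : ℝ × X in 𝓝 (s, x), |p.1| < |s| + 1 :=
      (isOpen_lt (by fun_prop) continuous_const).mem_nhds (by simp)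
    refine squeeze_zero_norm' ?_ hlim
    filter_upwards [hev] with p hp
    exact hC _ _ _ _ hp.le (by linarith)
  simpa [ContinuousAt] using h2.add h1

section General

variable {E F : Type*} [NormedAddCommGroup E] [NormedSpace ℝ E]
  [NormedAddCommGroup F] [NormedSpace ℝ F]

/-- One-sided Grönwall comparison with a time-dependent inhomogeneity `g`. -/
theorem norm_le_of_norm_deriv_le_of_nonneg {f f' : ℝ → F} {B g : ℝ → ℝ} {K : ℝ}
    (hf : ∀ s, HasDerivAt f (f' s) s)
    (bound : ∀ s, 0 ≤ s → ‖f' s‖ ≤ K * ‖f s‖ + g s)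
    (hB : ∀ s, HasDerivAt B (K * B s + g s) s) (h0 : ‖f 0‖ ≤ B 0) {s : ℝ} (hs : 0 ≤ s) :
    ‖f s‖ ≤ B s := by
  have key : ∀ ε > 0, ‖f s‖ ≤ B s + ε * Real.exp ((K + 1) * s) := by
    intro ε hε
    have hB' : ∀ r, HasDerivAt (fun r => B r + ε * Real.exp ((K + 1) * r))
        (K * B r + g r + ε * (Real.exp ((K + 1) * r) * (K + 1))) r := fun r => by
      have h := ((hasDerivAt_id r).const_mul (K + 1)).exp
      simp only [id, mul_one] at h
      exact (hB r).add (h.const_mul ε)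
    refine image_norm_le_of_norm_deriv_right_lt_deriv_boundary'
      (f := f) (f' := f') (a := 0) (b := s)
      (fun r _ => (hf r).continuousAt.continuousWithinAt)
      (fun r _ => (hf r).hasDerivWithinAt) ?_
      (fun r _ => (hB' r).continuousAt.continuousWithinAt)
      (fun r _ => (hB' r).hasDerivWithinAt) ?_ ⟨hs, le_rfl⟩
    · have : 0 < ε * Real.exp ((K + 1) * 0) := by positivity
      linarith
    · intro r hr hfr
      have h := bound r hr.1
      have hpos : 0 < ε * Real.exp ((K + 1) * r) := by positivity
      rw [hfr] at h
      nlinarith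
  have hlim : Tendsto (fun ε : ℝ => B s + ε * Real.exp ((K + 1) * s)) (𝓝[>] 0) (𝓝 (B s)) := by
    have : Continuous fun ε : ℝ => B s + ε * Real.exp ((K + 1) * s) := by fun_prop
    have h := this.tendsto 0
    simp only [zero_mul, add_zero] at h
    exact h.mono_left nhdsWithin_le_nhds
  exact ge_of_tendsto hlim (eventually_mem_nhdsWithin.mono key)

/-- Two-sided Grönwall comparison with a time-dependent inhomogeneity `g`. -/
theorem norm_le_of_norm_deriv_le {f f' : ℝ → F} {B g : ℝ → ℝ} {K : ℝ}
    (hf : ∀ s, HasDerivAt f (f' s) s) (bound : ∀ s, ‖f' s‖ ≤ K * ‖f s‖ + g |s|)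
    (hB : ∀ s, HasDerivAt B (K * B s + g s) s) (h0 : ‖f 0‖ ≤ B 0) (s : ℝ) :
    ‖f s‖ ≤ B |s| := by
  rcases le_total 0 s with hs | hs
  · rw [abs_of_nonneg hs]
    refine norm_le_of_norm_deriv_le_of_nonneg hf (fun r hr => ?_) hB h0 hs
    simpa only [abs_of_nonneg hr] using bound r
  · rw [abs_of_nonpos hs]
    have hf' : ∀ r, HasDerivAt (fun r => f (-r)) (-f' (-r)) r := fun r => by
      simpa [Function.comp_def] using (hf (-r)).scomp r (hasDerivAt_neg r)
    have := norm_le_of_norm_deriv_le_of_nonneg hf' (fun r hr => ?_) hB (by simpa using h0)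
      (neg_nonneg.2 hs)
    · simpa using this
    · simpa only [abs_neg, abs_of_nonneg hr, norm_neg] using bound (-r)

/-- If `∂ₛ g` is Lipschitz in the space variable, locally uniformly in time, then the spatial
derivative of `g` is jointly continuous. -/
theorem continuous_fderiv_of_lipschitz_deriv {g g' : ℝ → E → F} {C : ℝ → ℝ}
    (hg : ∀ s, ContDiff ℝ 1 (g s)) (hg' : ∀ s x, HasDerivAt (fun r => g r x) (g' s x) s)
    (hC0 : ∀ R, 0 ≤ C R)
    (hC : ∀ R s x y, |s| ≤ R → ‖g' s x - g' s y‖ ≤ C R * ‖x - y‖) :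
    Continuous fun p : ℝ × E => fderiv ℝ (g p.1) p.2 := by
  refine continuous_uncurry_of_lipschitz_left (f := fun s x => fderiv ℝ (g s) x) (C := C)
    (fun s => (hg s).continuous_fderiv one_ne_zero) fun R s r x hs hr => ?_
  have hd : ∀ s, DifferentiableAt ℝ (g s) x := fun s =>
    ((hg s).differentiable one_ne_zero).differentiableAt
  refine HasFDerivAt.le_of_lip' ((hd s).hasFDerivAt.sub (hd r).hasFDerivAt)
    (mul_nonneg (hC0 R) (abs_nonneg _)) (Eventually.of_forall fun y => ?_)
  have := Convex.norm_image_sub_le_of_norm_hasDerivWithin_le (s := Icc (-R) R)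
    (f := fun r => g r y - g r x) (f' := fun r => g' r y - g' r x) (C := C R * ‖y - x‖)
    (fun r _ => ((hg' r y).sub (hg' r x)).hasDerivWithinAt)
    (fun r hr => hC R r y x (abs_le.2 hr)) (convex_Icc _ _) (abs_le.1 hr) (abs_le.1 hs)
  calc ‖(g s - g r) y - (g s - g r) x‖ = ‖g s y - g s x - (g r y - g r x)‖ := by
        simp only [Pi.sub_apply]; congr 1; abel
    _ ≤ C R * ‖y - x‖ * ‖s - r‖ := this
    _ = C R * |s - r| * ‖y - x‖ := by rw [Real.norm_eq_abs]; ring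

/-- Exchange of the time derivative with the spatial derivative. -/
theorem hasDerivAt_fderiv_of_continuous [CompleteSpace F] {g g' : ℝ → E → F}
    {G : ℝ → E → E →L[ℝ] F} {C : ℝ → ℝ}
    (hg : ∀ s, Differentiable ℝ (g s)) (hg' : ∀ s x, HasDerivAt (fun r => g r x) (g' s x) s)
    (hG : ∀ s x, HasFDerivAt (g' s) (G s x) x)
    (hgc : ∀ x, Continuous fun s => g' s x) (hGc : ∀ x, Continuous fun s => G s x)
    (hC : ∀ R s x, |s| ≤ R → ‖G s x‖ ≤ C R) (s : ℝ) (x : E) :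
    HasDerivAt (fun r => fderiv ℝ (g r) x) (G s x) s := by
  have hintegral : ∀ r y, g r y = g 0 y + ∫ q in (0 : ℝ)..r, g' q y := fun r y => by
    rw [intervalIntegral.integral_eq_sub_of_hasDerivAt (fun q _ => hg' q y)
      ((hgc y).intervalIntegrable _ _)]
    abel
  have hfd : ∀ r, fderiv ℝ (g r) x = fderiv ℝ (g 0) x + ∫ q in (0 : ℝ)..r, G q x := fun r => by
    have h1 : HasFDerivAt (fun y => ∫ q in (0 : ℝ)..r, g' q y) (∫ q in (0 : ℝ)..r, G q x) x := by
      refine intervalIntegral.hasFDerivAt_integral_of_dominated_of_fderiv_le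
        (s := univ) (bound := fun _ => C |r|) (F := fun y q => g' q y) (F' := fun y q => G q y)
        univ_mem (Eventually.of_forall fun y => (hgc y).aestronglyMeasurable)
        ((hgc x).intervalIntegrable _ _) (hGc x).aestronglyMeasurable ?_
        intervalIntegrable_const (Eventually.of_forall fun q _ y _ => hG q y)
      refine Eventually.of_forall fun q hq y _ => hC _ _ _ ?_
      rcases Set.mem_uIoc.1 hq with h | h
      · rw [abs_of_pos h.1]; exact h.2.trans (le_abs_self r)
      · rw [abs_of_nonpos h.2]; exact (neg_le_neg h.1.le).trans (neg_le_abs r)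
    have h2 : g r = fun y => g 0 y + ∫ q in (0 : ℝ)..r, g' q y := funext (hintegral r)
    rw [h2]
    exact ((hg 0 x).hasFDerivAt.add h1).fderiv
  rw [funext hfd]
  exact (intervalIntegral.integral_hasDerivAt_right ((hGc x).intervalIntegrable _ _)
    (hGc x).stronglyMeasurable.stronglyMeasurableAtFilter (hGc x).continuousAt).const_add _

end General

/-- `Φ` is a global flow, of class `C²` in space, of a vector field `a` whose derivatives of order
at most two are bounded by `M`. -/
structure IsBoundedFlow {E : Type*} [NormedAddCommGroup E] [NormedSpace ℝ E]
    (M : ℝ) (a : E → E) (Φ : ℝ → E → E) : Prop where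
  contDiff_field : ContDiff ℝ 2 a
  norm_field_le : ∀ x, ‖a x‖ ≤ M
  norm_fderiv_field_le : ∀ x, ‖fderiv ℝ a x‖ ≤ M
  norm_fderiv_fderiv_field_le : ∀ x, ‖fderiv ℝ (fderiv ℝ a) x‖ ≤ M
  flow_zero : ∀ x, Φ 0 x = x
  hasDerivAt_flow : ∀ s x, HasDerivAt (fun r => Φ r x) (a (Φ s x)) s
  contDiff_flow : ∀ s, ContDiff ℝ 2 (Φ s)

namespace IsBoundedFlow

variable {E V : Type*} [NormedAddCommGroup E] [NormedSpace ℝ E] [NormedAddCommGroup V]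
  [NormedSpace ℝ V] {M : ℝ} {a : E → E} {Φ : ℝ → E → E} {H : V → E} {ℓ : V →L[ℝ] ℝ}

theorem nonneg (h : IsBoundedFlow M a Φ) : 0 ≤ M := (norm_nonneg _).trans (h.norm_field_le 0)

theorem differentiable_field (h : IsBoundedFlow M a Φ) : Differentiable ℝ a :=
  h.contDiff_field.differentiable two_ne_zero

theorem contDiff_fderiv_field (h : IsBoundedFlow M a Φ) : ContDiff ℝ 1 (fderiv ℝ a) :=
  h.contDiff_field.fderiv_right (by norm_num)

theorem differentiable_flow (h : IsBoundedFlow M a Φ) (s : ℝ) : Differentiable ℝ (Φ s) :=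
  (h.contDiff_flow s).differentiable two_ne_zero

theorem contDiff_fderiv_flow (h : IsBoundedFlow M a Φ) (s : ℝ) : ContDiff ℝ 1 (fderiv ℝ (Φ s)) :=
  (h.contDiff_flow s).fderiv_right (by norm_num)

theorem continuous_flow_left (h : IsBoundedFlow M a Φ) (x : E) : Continuous fun s => Φ s x :=
  continuous_iff_continuousAt.2 fun s => (h.hasDerivAt_flow s x).continuousAt

theorem norm_field_sub_le (h : IsBoundedFlow M a Φ) (x y : E) : ‖a x - a y‖ ≤ M * ‖x - y‖ :=
  convex_univ.norm_image_sub_le_of_norm_fderiv_le (fun z _ => h.differentiable_field z)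
    (fun z _ => h.norm_fderiv_field_le z) (mem_univ _) (mem_univ _)

theorem norm_fderiv_field_sub_le (h : IsBoundedFlow M a Φ) (x y : E) :
    ‖fderiv ℝ a x - fderiv ℝ a y‖ ≤ M * ‖x - y‖ :=
  convex_univ.norm_image_sub_le_of_norm_fderiv_le
    (fun z _ => h.contDiff_fderiv_field.differentiable one_ne_zero z)
    (fun z _ => h.norm_fderiv_fderiv_field_le z) (mem_univ _) (mem_univ _)

theorem norm_flow_sub_le (h : IsBoundedFlow M a Φ) (s : ℝ) (x y : E) :
    ‖Φ s x - Φ s y‖ ≤ Real.exp (M * |s|) * ‖x - y‖ := by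
  refine norm_le_of_norm_deriv_le (f := fun s => Φ s x - Φ s y) (K := M) (g := fun _ => 0)
    (B := fun r => Real.exp (M * r) * ‖x - y‖)
    (fun r => (h.hasDerivAt_flow r x).sub (h.hasDerivAt_flow r y))
    (fun r => by simpa using h.norm_field_sub_le _ _) (fun r => ?_) (by simp [h.flow_zero]) s
  have := ((hasDerivAt_id r).const_mul M).exp.mul_const ‖x - y‖
  simp only [id, mul_one] at this
  exact this.congr_deriv (by ring)

theorem norm_fderiv_flow_le (h : IsBoundedFlow M a Φ) (s : ℝ) (x : E) :
    ‖fderiv ℝ (Φ s) x‖ ≤ Real.exp (M * |s|) :=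
  norm_fderiv_le_of_lip' ℝ (Real.exp_pos _).le
    (Eventually.of_forall fun y => h.norm_flow_sub_le s y x)

theorem exp_le_exp (h : IsBoundedFlow M a Φ) {s R : ℝ} (hs : |s| ≤ R) :
    Real.exp (M * |s|) ≤ Real.exp (M * R) :=
  Real.exp_le_exp.2 (mul_le_mul_of_nonneg_left hs h.nonneg)

theorem continuous_flow (h : IsBoundedFlow M a Φ) : Continuous fun p : ℝ × E => Φ p.1 p.2 :=
  continuous_uncurry_of_lipschitz_left (C := fun _ => M) (fun s => (h.contDiff_flow s).continuous)
    fun _ s r x _ _ => convex_univ.norm_image_sub_le_of_norm_hasDerivWithin_le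
      (fun q _ => (h.hasDerivAt_flow q x).hasDerivWithinAt) (fun _ _ => h.norm_field_le _)
      (mem_univ r) (mem_univ s)

theorem continuous_fderiv_flow (h : IsBoundedFlow M a Φ) :
    Continuous fun p : ℝ × E => fderiv ℝ (Φ p.1) p.2 := by
  refine continuous_fderiv_of_lipschitz_deriv (C := fun R => M * Real.exp (M * R))
    (fun s => (h.contDiff_flow s).of_le (by norm_num)) h.hasDerivAt_flow
    (fun R => mul_nonneg h.nonneg (Real.exp_pos _).le) fun R s x y hs => ?_
  calc ‖a (Φ s x) - a (Φ s y)‖ ≤ M * (Real.exp (M * |s|) * ‖x - y‖) :=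
        (h.norm_field_sub_le _ _).trans
          (mul_le_mul_of_nonneg_left (h.norm_flow_sub_le s x y) h.nonneg)
    _ ≤ M * (Real.exp (M * R) * ‖x - y‖) := by
        gcongr
        · exact h.nonneg
        · exact h.nonneg
    _ = M * Real.exp (M * R) * ‖x - y‖ := by ring

theorem continuous_toSpanSingleton_field_flow (h : IsBoundedFlow M a Φ) :
    Continuous fun p : ℝ × E => ContinuousLinearMap.toSpanSingleton ℝ (a (Φ p.1 p.2)) :=
  (ContinuousLinearMap.toSpanSingletonCLE (𝕜 := ℝ) (E := E)).continuous.comp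
    (h.contDiff_field.continuous.comp h.continuous_flow)

theorem hasFDerivAt_uncurry (h : IsBoundedFlow M a Φ) (p : ℝ × E) :
    HasFDerivAt (fun q : ℝ × E => Φ q.1 q.2)
      ((ContinuousLinearMap.toSpanSingleton ℝ (a (Φ p.1 p.2))).coprod (fderiv ℝ (Φ p.1) p.2)) p := 
  (hasStrictFDerivAt_uncurry_coprod (f := Φ) (u := p)
    (f₁ := fun s x => ContinuousLinearMap.toSpanSingleton ℝ (a (Φ s x)))
    (f₂ := fun s x => fderiv ℝ (Φ s) x)
    (Eventually.of_forall fun q => (h.hasDerivAt_flow q.1 q.2).hasFDerivAt)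
    (Eventually.of_forall fun q => (h.differentiable_flow q.1 q.2).hasFDerivAt)
    h.continuous_toSpanSingleton_field_flow.continuousAt
    h.continuous_fderiv_flow.continuousAt).hasFDerivAt

theorem contDiff_one_uncurry (h : IsBoundedFlow M a Φ) :
    ContDiff ℝ 1 fun q : ℝ × E => Φ q.1 q.2 :=
  contDiff_one_iff_hasFDerivAt.2
    ⟨_, h.continuous_toSpanSingleton_field_flow.continuousLinearMapCoprod
      h.continuous_fderiv_flow, h.hasFDerivAt_uncurry⟩

theorem continuous_toSpanSingleton_deriv_fderiv_flow (h : IsBoundedFlow M a Φ) :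
    Continuous fun p : ℝ × E => ContinuousLinearMap.toSpanSingleton ℝ
      (fderiv ℝ a (Φ p.1 p.2) ∘L fderiv ℝ (Φ p.1) p.2) :=
  (ContinuousLinearMap.toSpanSingletonCLE (𝕜 := ℝ) (E := E →L[ℝ] E)).continuous.comp
    ((h.contDiff_fderiv_field.continuous.comp h.continuous_flow).clm_comp
      h.continuous_fderiv_flow)

theorem exp_mul_exp_sub_one_nonneg (h : IsBoundedFlow M a Φ) {R : ℝ} (hR : 0 ≤ R) :
    0 ≤ Real.exp (M * R) * (Real.exp (M * R) - 1) :=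
  mul_nonneg (Real.exp_pos _).le (sub_nonneg.2 (Real.one_le_exp (mul_nonneg h.nonneg hR)))

theorem norm_deriv_fderiv_flow_sub_le (h : IsBoundedFlow M a Φ) (s : ℝ) (x y : E) :
    ‖fderiv ℝ a (Φ s x) ∘L fderiv ℝ (Φ s) x - fderiv ℝ a (Φ s y) ∘L fderiv ℝ (Φ s) y‖ ≤
      M * ‖fderiv ℝ (Φ s) x - fderiv ℝ (Φ s) y‖ + M * Real.exp (M * |s|) ^ 2 * ‖x - y‖ := by
  have hM := h.nonneg
  calc _ = ‖fderiv ℝ a (Φ s x) ∘L (fderiv ℝ (Φ s) x - fderiv ℝ (Φ s) y) +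
        (fderiv ℝ a (Φ s x) - fderiv ℝ a (Φ s y)) ∘L fderiv ℝ (Φ s) y‖ := by
        rw [ContinuousLinearMap.comp_sub, ContinuousLinearMap.sub_comp]; congr 1; abel
    _ ≤ ‖fderiv ℝ a (Φ s x)‖ * ‖fderiv ℝ (Φ s) x - fderiv ℝ (Φ s) y‖ +
        ‖fderiv ℝ a (Φ s x) - fderiv ℝ a (Φ s y)‖ * ‖fderiv ℝ (Φ s) y‖ :=
        (norm_add_le _ _).trans (add_le_add (ContinuousLinearMap.opNorm_comp_le _ _)
          (ContinuousLinearMap.opNorm_comp_le _ _))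
    _ ≤ M * ‖fderiv ℝ (Φ s) x - fderiv ℝ (Φ s) y‖ +
        (M * (Real.exp (M * |s|) * ‖x - y‖)) * Real.exp (M * |s|) := by
        gcongr
        · exact h.norm_fderiv_field_le _
        · exact (h.norm_fderiv_field_sub_le _ _).trans
            (mul_le_mul_of_nonneg_left (h.norm_flow_sub_le s x y) hM)
        · exact h.norm_fderiv_flow_le s y
    _ = _ := by ring

theorem hasFDerivAt_comp (h : IsBoundedFlow M a Φ) (hH : ContDiff ℝ 2 H) (t : V) :
    HasFDerivAt (fun t => Φ (ℓ t) (H t))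
      (ℓ.smulRight (a (Φ (ℓ t) (H t))) + fderiv ℝ (Φ (ℓ t)) (H t) ∘L fderiv ℝ H t) t := by
  have hHt := (hH.differentiable two_ne_zero t).hasFDerivAt
  refine ((h.hasFDerivAt_uncurry (ℓ t, H t)).comp t (ℓ.hasFDerivAt.prodMk hHt)).congr_fderiv ?_
  ext w
  simp

theorem norm_fderiv_comp_le (h : IsBoundedFlow M a Φ) (hH : ContDiff ℝ 2 H) (hℓ : ‖ℓ‖ ≤ 1)
    (t : V) : ‖fderiv ℝ (fun t => Φ (ℓ t) (H t)) t‖ ≤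
      M + Real.exp (M * |ℓ t|) * ‖fderiv ℝ H t‖ := by
  rw [(h.hasFDerivAt_comp hH t).fderiv]
  refine (norm_add_le _ _).trans (add_le_add ?_ ((ContinuousLinearMap.opNorm_comp_le _ _).trans
    (mul_le_mul_of_nonneg_right (h.norm_fderiv_flow_le _ _) (norm_nonneg _))))
  rw [ContinuousLinearMap.norm_smulRight_apply]
  exact (mul_le_mul hℓ (h.norm_field_le _) (norm_nonneg _) zero_le_one).trans_eq (one_mul M)

variable [CompleteSpace E]

/-- The first variational equation. -/
theorem hasDerivAt_fderiv_flow (h : IsBoundedFlow M a Φ) (s : ℝ) (x : E) :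
    HasDerivAt (fun r => fderiv ℝ (Φ r) x) (fderiv ℝ a (Φ s x) ∘L fderiv ℝ (Φ s) x) s := by
  refine hasDerivAt_fderiv_of_continuous (C := fun R => M * Real.exp (M * R))
    (G := fun s x => fderiv ℝ a (Φ s x) ∘L fderiv ℝ (Φ s) x) h.differentiable_flow
    h.hasDerivAt_flow
    (fun s x => (h.differentiable_field _).hasFDerivAt.comp x
      (h.differentiable_flow s x).hasFDerivAt)
    (fun x => h.contDiff_field.continuous.comp (h.continuous_flow_left x))
    (fun x => ?_) (fun R s x hs => ?_) s x
  · exact (h.contDiff_fderiv_field.continuous.comp (h.continuous_flow_left x)).clm_comp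
      (h.continuous_fderiv_flow.comp (by fun_prop : Continuous fun s : ℝ => (s, x)))
  · exact (ContinuousLinearMap.opNorm_comp_le _ _).trans (mul_le_mul (h.norm_fderiv_field_le _)
      ((h.norm_fderiv_flow_le s x).trans (h.exp_le_exp hs)) (norm_nonneg _) h.nonneg)

theorem norm_fderiv_flow_sub_le (h : IsBoundedFlow M a Φ) (s : ℝ) (x y : E) :
    ‖fderiv ℝ (Φ s) x - fderiv ℝ (Φ s) y‖ ≤
      Real.exp (M * |s|) * (Real.exp (M * |s|) - 1) * ‖x - y‖ := by
  have hid : Φ 0 = id := funext h.flow_zero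
  refine norm_le_of_norm_deriv_le (f := fun s => fderiv ℝ (Φ s) x - fderiv ℝ (Φ s) y) (K := M)
    (g := fun r => M * Real.exp (M * r) ^ 2 * ‖x - y‖)
    (B := fun r => Real.exp (M * r) * (Real.exp (M * r) - 1) * ‖x - y‖)
    (fun r => (h.hasDerivAt_fderiv_flow r x).sub (h.hasDerivAt_fderiv_flow r y))
    (fun r => h.norm_deriv_fderiv_flow_sub_le r x y) (fun r => ?_) (by simp [hid]) s
  have he := ((hasDerivAt_id r).const_mul M).exp
  simp only [id, mul_one] at he
  exact ((he.mul (he.sub_const 1)).mul_const ‖x - y‖).congr_deriv (by ring)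

theorem norm_fderiv_fderiv_flow_le (h : IsBoundedFlow M a Φ) (s : ℝ) (x : E) :
    ‖fderiv ℝ (fderiv ℝ (Φ s)) x‖ ≤ Real.exp (M * |s|) * (Real.exp (M * |s|) - 1) :=
  norm_fderiv_le_of_lip' ℝ (h.exp_mul_exp_sub_one_nonneg (abs_nonneg s))
    (Eventually.of_forall fun y => h.norm_fderiv_flow_sub_le s y x)

theorem continuous_fderiv_fderiv_flow (h : IsBoundedFlow M a Φ) :
    Continuous fun p : ℝ × E => fderiv ℝ (fderiv ℝ (Φ p.1)) p.2 := by
  have hM := h.nonneg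
  refine continuous_fderiv_of_lipschitz_deriv (g := fun s => fderiv ℝ (Φ s))
    (C := fun R => 2 * M * Real.exp (M * R) ^ 2)
    h.contDiff_fderiv_flow h.hasDerivAt_fderiv_flow (fun R => by positivity)
    fun R s x y hs => (h.norm_deriv_fderiv_flow_sub_le s x y).trans ?_
  have hJ : ‖fderiv ℝ (Φ s) x - fderiv ℝ (Φ s) y‖ ≤ Real.exp (M * |s|) ^ 2 * ‖x - y‖ := by
    refine (h.norm_fderiv_flow_sub_le s x y).trans (mul_le_mul_of_nonneg_right ?_ (norm_nonneg _))
    nlinarith [Real.exp_pos (M * |s|)]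
  calc _ ≤ M * (Real.exp (M * |s|) ^ 2 * ‖x - y‖) + M * Real.exp (M * |s|) ^ 2 * ‖x - y‖ := by
        gcongr
    _ = 2 * M * Real.exp (M * |s|) ^ 2 * ‖x - y‖ := by ring
    _ ≤ 2 * M * Real.exp (M * R) ^ 2 * ‖x - y‖ := by gcongr

theorem hasFDerivAt_fderiv_uncurry (h : IsBoundedFlow M a Φ) (p : ℝ × E) :
    HasFDerivAt (fun q : ℝ × E => fderiv ℝ (Φ q.1) q.2)
      ((ContinuousLinearMap.toSpanSingleton ℝ
        (fderiv ℝ a (Φ p.1 p.2) ∘L fderiv ℝ (Φ p.1) p.2)).coprod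
          (fderiv ℝ (fderiv ℝ (Φ p.1)) p.2)) p := 
  (hasStrictFDerivAt_uncurry_coprod (f := fun s x => fderiv ℝ (Φ s) x) (u := p)
    (f₁ := fun s x => ContinuousLinearMap.toSpanSingleton ℝ
      (fderiv ℝ a (Φ s x) ∘L fderiv ℝ (Φ s) x))
    (f₂ := fun s x => fderiv ℝ (fderiv ℝ (Φ s)) x)
    (Eventually.of_forall fun q => (h.hasDerivAt_fderiv_flow q.1 q.2).hasFDerivAt)
    (Eventually.of_forall fun q =>
      ((h.contDiff_fderiv_flow q.1).differentiable one_ne_zero q.2).hasFDerivAt)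
    h.continuous_toSpanSingleton_deriv_fderiv_flow.continuousAt
    h.continuous_fderiv_fderiv_flow.continuousAt).hasFDerivAt

theorem contDiff_one_fderiv_uncurry (h : IsBoundedFlow M a Φ) :
    ContDiff ℝ 1 fun q : ℝ × E => fderiv ℝ (Φ q.1) q.2 :=
  contDiff_one_iff_hasFDerivAt.2
    ⟨_, h.continuous_toSpanSingleton_deriv_fderiv_flow.continuousLinearMapCoprod
      h.continuous_fderiv_fderiv_flow, h.hasFDerivAt_fderiv_uncurry⟩

theorem contDiff_two_uncurry (h : IsBoundedFlow M a Φ) :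
    ContDiff ℝ 2 fun q : ℝ × E => Φ q.1 q.2 := by
  refine (contDiff_succ_iff_hasFDerivAt (n := 1)).2 ⟨_, ?_, h.hasFDerivAt_uncurry⟩
  have h1 : ContDiff ℝ 1 fun q : ℝ × E =>
      ContinuousLinearMap.toSpanSingleton ℝ (a (Φ q.1 q.2)) :=
    (ContinuousLinearMap.toSpanSingletonCLE (𝕜 := ℝ) (E := E)).contDiff.comp
      ((h.contDiff_field.of_le (by norm_num)).comp h.contDiff_one_uncurry)
  exact (ContinuousLinearMap.coprodEquivL (𝕜 := ℝ) (S := ℝ) (E := ℝ) (F := E)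
    (G := E)).contDiff.comp (h1.prodMk h.contDiff_one_fderiv_uncurry)

theorem contDiff_two_comp (h : IsBoundedFlow M a Φ) (hH : ContDiff ℝ 2 H) :
    ContDiff ℝ 2 fun t => Φ (ℓ t) (H t) :=
  h.contDiff_two_uncurry.comp (ℓ.contDiff.prodMk hH)

theorem norm_fderiv_fderiv_comp_le (h : IsBoundedFlow M a Φ) (hH : ContDiff ℝ 2 H) (hℓ : ‖ℓ‖ ≤ 1)
    (t : V) : ‖fderiv ℝ (fderiv ℝ fun t => Φ (ℓ t) (H t)) t‖ ≤
      M ^ 2 + 2 * M * Real.exp (M * |ℓ t|) * ‖fderiv ℝ H t‖ +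
        Real.exp (M * |ℓ t|) * (Real.exp (M * |ℓ t|) - 1) * ‖fderiv ℝ H t‖ ^ 2 +
        Real.exp (M * |ℓ t|) * ‖fderiv ℝ (fderiv ℝ H) t‖ := by
  have hM := h.nonneg
  have hK := h.exp_mul_exp_sub_one_nonneg (abs_nonneg (ℓ t))
  have hHt := (hH.differentiable two_ne_zero t).hasFDerivAt
  have hHt2 := (((hH.fderiv_right (m := 1) (by norm_num)).differentiable one_ne_zero) t).hasFDerivAt
  have hΦ' : fderiv ℝ (fun t => Φ (ℓ t) (H t)) = fun t =>
      ℓ.smulRight (a (Φ (ℓ t) (H t))) + fderiv ℝ (Φ (ℓ t)) (H t) ∘L fderiv ℝ H t :=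
    funext fun t => (h.hasFDerivAt_comp hH t).fderiv
  have hnorm := h.norm_fderiv_comp_le hH hℓ t
  have hcomp := ((h.contDiff_two_comp (ℓ := ℓ) hH).differentiable two_ne_zero t).hasFDerivAt
  set L := fderiv ℝ (fun t => Φ (ℓ t) (H t)) t
  have d1 := ((ContinuousLinearMap.smulRightL ℝ V E ℓ).hasFDerivAt).comp t
    ((h.differentiable_field _).hasFDerivAt.comp t hcomp)
  have d2 := ((h.hasFDerivAt_fderiv_uncurry (ℓ t, H t)).comp t
    (ℓ.hasFDerivAt.prodMk hHt)).clm_comp hHt2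
  have d : fderiv ℝ (fun t => ℓ.smulRight (a (Φ (ℓ t) (H t))) +
      fderiv ℝ (Φ (ℓ t)) (H t) ∘L fderiv ℝ H t) t = _ := (d1.add d2).fderiv
  rw [hΦ', d]
  set u := Real.exp (M * |ℓ t|)
  have hJ : ‖fderiv ℝ (Φ (ℓ t)) (H t)‖ ≤ u := h.norm_fderiv_flow_le _ _
  refine ContinuousLinearMap.opNorm_le_bound _ (by positivity) fun w => ?_
  have hℓw : ‖ℓ w‖ ≤ ‖w‖ := (ℓ.le_opNorm w).trans
    (mul_le_of_le_one_left (norm_nonneg _) hℓ)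
  have hHw : ‖fderiv ℝ H t w‖ ≤ ‖fderiv ℝ H t‖ * ‖w‖ := ContinuousLinearMap.le_opNorm _ _
  have b1 : ‖ℓ.smulRight (fderiv ℝ a (Φ (ℓ t) (H t)) (L w))‖ ≤
      M * ((M + u * ‖fderiv ℝ H t‖) * ‖w‖) := by
    rw [ContinuousLinearMap.norm_smulRight_apply]
    calc _ ≤ 1 * (M * ((M + u * ‖fderiv ℝ H t‖) * ‖w‖)) := by
          gcongr
          refine (ContinuousLinearMap.le_opNorm _ _).trans ?_
          gcongr
          · exact h.norm_fderiv_field_le _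
          · exact (L.le_opNorm w).trans (by gcongr)
      _ = _ := one_mul _
  have b2 : ‖fderiv ℝ (Φ (ℓ t)) (H t) ∘L fderiv ℝ (fderiv ℝ H) t w‖ ≤
      u * (‖fderiv ℝ (fderiv ℝ H) t‖ * ‖w‖) := by
    refine (ContinuousLinearMap.opNorm_comp_le _ _).trans ?_
    gcongr
    exact ContinuousLinearMap.le_opNorm _ _
  have b3 : ‖(ℓ w • (fderiv ℝ a (Φ (ℓ t) (H t)) ∘L fderiv ℝ (Φ (ℓ t)) (H t)) +
      fderiv ℝ (fderiv ℝ (Φ (ℓ t))) (H t) (fderiv ℝ H t w)) ∘L fderiv ℝ H t‖ ≤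
      (‖w‖ * (M * u) + u * (u - 1) * (‖fderiv ℝ H t‖ * ‖w‖)) * ‖fderiv ℝ H t‖ := by
    refine (ContinuousLinearMap.opNorm_comp_le _ _).trans ?_
    gcongr
    refine (norm_add_le _ _).trans (add_le_add ?_ ((ContinuousLinearMap.le_opNorm _ _).trans ?_))
    · rw [norm_smul]
      gcongr
      refine (ContinuousLinearMap.opNorm_comp_le _ _).trans ?_
      gcongr
      exact h.norm_fderiv_field_le _
    · exact mul_le_mul (h.norm_fderiv_fderiv_flow_le _ _) hHw (norm_nonneg _) hK
  calc _ = ‖ℓ.smulRight (fderiv ℝ a (Φ (ℓ t) (H t)) (L w)) +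
        (fderiv ℝ (Φ (ℓ t)) (H t) ∘L fderiv ℝ (fderiv ℝ H) t w +
        (ℓ w • (fderiv ℝ a (Φ (ℓ t) (H t)) ∘L fderiv ℝ (Φ (ℓ t)) (H t)) +
      fderiv ℝ (fderiv ℝ (Φ (ℓ t))) (H t) (fderiv ℝ H t w)) ∘L fderiv ℝ H t)‖ := by
        congr 1
    _ ≤ M * ((M + u * ‖fderiv ℝ H t‖) * ‖w‖) + (u * (‖fderiv ℝ (fderiv ℝ H) t‖ * ‖w‖) +
      (‖w‖ * (M * u) + u * (u - 1) * (‖fderiv ℝ H t‖ * ‖w‖)) * ‖fderiv ℝ H t‖) :=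
        (norm_add_le _ _).trans (add_le_add b1 ((norm_add_le _ _).trans (add_le_add b2 b3)))
    _ = _ := by ring

end IsBoundedFlow

section Hmap

variable {d : ℕ} {Φ : Fin d → ℝ → EuclideanSpace ℝ (Fin d) → EuclideanSpace ℝ (Fin d)}
  {x₀ : EuclideanSpace ℝ (Fin d)}

theorem Hmap_zero : Hmap Φ x₀ 0 = fun _ => x₀ := rfl

theorem Hmap_succ_of_lt {i : ℕ} (hi : i < d) :
    Hmap Φ x₀ (i + 1) = fun t => Φ ⟨i, hi⟩ (EuclideanSpace.proj ⟨i, hi⟩ t) (Hmap Φ x₀ i t) := by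
  funext t
  simp [Hmap, List.range_succ, hi]

theorem norm_euclideanSpace_proj_le (i : Fin d) :
    ‖(EuclideanSpace.proj i : EuclideanSpace ℝ (Fin d) →L[ℝ] ℝ)‖ ≤ 1 :=
  ContinuousLinearMap.opNorm_le_bound _ zero_le_one fun t => by
    simpa using PiLp.norm_apply_le t i

theorem contDiff_Hmap_and_norm_le {M : ℝ} (hM1 : M ≤ 1)
    {a : Fin d → EuclideanSpace ℝ (Fin d) → EuclideanSpace ℝ (Fin d)}
    (hflow : ∀ i, IsBoundedFlow M (a i) (Φ i)) (i : ℕ) (hi : i ≤ d) :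
    ContDiff ℝ 2 (Hmap Φ x₀ i) ∧ ∀ t : EuclideanSpace ℝ (Fin d),
      ‖fderiv ℝ (Hmap Φ x₀ i) t‖ ≤ i * Real.exp (M * ∑ k : Fin i, |t (Fin.castLE hi k)|) ∧
      ‖fderiv ℝ (fderiv ℝ (Hmap Φ x₀ i)) t‖ ≤
        (i * Real.exp (M * ∑ k : Fin i, |t (Fin.castLE hi k)|)) ^ 2 := by
  induction i with
  | zero =>
    rw [Hmap_zero]
    refine ⟨contDiff_const, fun t => ⟨by simp, ?_⟩⟩
    rw [fderiv_fun_const, fderiv_zero]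
    exact (norm_zero (E := EuclideanSpace ℝ (Fin d) →L[ℝ] EuclideanSpace ℝ (Fin d) →L[ℝ]
      EuclideanSpace ℝ (Fin d))).trans_le (by positivity)
  | succ i ih =>
    obtain ⟨hH, hbound⟩ := ih (Nat.le_of_succ_le hi)
    have hlt : i < d := hi
    have hfl := hflow ⟨i, hlt⟩
    have hM := hfl.nonneg
    rw [Hmap_succ_of_lt hlt]
    refine ⟨hfl.contDiff_two_comp hH, fun t => ?_⟩
    obtain ⟨h1, h2⟩ := hbound t
    have b1 := hfl.norm_fderiv_comp_le hH (norm_euclideanSpace_proj_le ⟨i, hlt⟩) t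
    have b2 := hfl.norm_fderiv_fderiv_comp_le hH (norm_euclideanSpace_proj_le ⟨i, hlt⟩) t
    have hproj : EuclideanSpace.proj (𝕜 := ℝ) (⟨i, hlt⟩ : Fin d) t = t ⟨i, hlt⟩ := rfl
    have hsum : Real.exp (M * ∑ k : Fin (i + 1), |t (Fin.castLE hi k)|) =
        Real.exp (M * ∑ k : Fin i, |t (Fin.castLE (Nat.le_of_succ_le hi) k)|) *
          Real.exp (M * |t ⟨i, hlt⟩|) := by
      rw [Fin.sum_univ_castSucc, mul_add, Real.exp_add]
      rfl
    rw [hproj] at b1 b2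
    rw [hsum]
    have hu : 1 ≤ Real.exp (M * |t ⟨i, hlt⟩|) := Real.one_le_exp (by positivity)
    have hv : 1 ≤ Real.exp (M * ∑ k : Fin i, |t (Fin.castLE (Nat.le_of_succ_le hi) k)|) :=
      Real.one_le_exp (by positivity)
    set u := Real.exp (M * |t ⟨i, hlt⟩|)
    set v := Real.exp (M * ∑ k : Fin i, |t (Fin.castLE (Nat.le_of_succ_le hi) k)|)
    set p := ‖fderiv ℝ (Hmap Φ x₀ i) t‖
    set q := ‖fderiv ℝ (fderiv ℝ (Hmap Φ x₀ i)) t‖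
    have hu1 : 0 ≤ u - 1 := sub_nonneg.2 hu
    have huv : 1 ≤ v * u := one_le_mul_of_one_le_of_one_le hv hu
    push_cast
    constructor
    · calc _ ≤ M + u * p := b1
        _ ≤ 1 + u * (i * v) := by gcongr
        _ ≤ v * u + u * (i * v) := by gcongr
        _ = _ := by ring
    · calc _ ≤ M ^ 2 + 2 * M * u * p + u * (u - 1) * p ^ 2 + u * q := b2
        _ ≤ 1 ^ 2 + 2 * 1 * u * (i * v) + u * (u - 1) * (i * v) ^ 2 + u * (i * v) ^ 2 := by
          gcongr
        _ = (1 + i * (v * u)) ^ 2 := by ring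
        _ ≤ (v * u + i * (v * u)) ^ 2 := by gcongr
        _ = _ := by ring

end Hmap

/-- the map `H(𝐭) = Φ⁽ᵈ⁾_{t_d} ∘ ⋯ ∘ Φ⁽¹⁾_{t₁}(x₀)` is `C²` with
`‖dH(𝐭)‖ ≤ 2^{d+1} e^{M|𝐭|₁}` and `‖d²H(𝐭)‖ ≤ 2^{2d+2} e^{2M|𝐭|₁}`. -/
theorem stmt_12 (d : ℕ) (hd : 1 ≤ d) (M : ℝ) (hM0 : 0 < M) (hM1 : M ≤ 1)
    (a : Fin d → EuclideanSpace ℝ (Fin d) → EuclideanSpace ℝ (Fin d))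
    (ha : ∀ i, ContDiff ℝ 2 (a i))
    (haM : ∀ i x, ‖a i x‖ + ‖iteratedFDeriv ℝ 1 (a i) x‖ +
      ‖iteratedFDeriv ℝ 2 (a i) x‖ ≤ M)
    (Φ : Fin d → ℝ → EuclideanSpace ℝ (Fin d) → EuclideanSpace ℝ (Fin d))
    (hΦ0 : ∀ i x, Φ i 0 x = x)
    (hΦ : ∀ (i : Fin d) (t : ℝ) (x : EuclideanSpace ℝ (Fin d)),
      HasDerivAt (fun s => Φ i s x) (a i (Φ i t x)) t)
    (hΦreg : ∀ (i : Fin d) (t : ℝ), ContDiff ℝ 2 (Φ i t))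
    (x₀ : EuclideanSpace ℝ (Fin d)) :
    ContDiff ℝ 2 (Hmap Φ x₀ d) ∧
    ∀ t : EuclideanSpace ℝ (Fin d),
      ‖fderiv ℝ (Hmap Φ x₀ d) t‖ ≤ 2 ^ (d + 1) * Real.exp (M * ∑ i, |t i|) ∧
      ‖iteratedFDeriv ℝ 2 (Hmap Φ x₀ d) t‖ ≤
        2 ^ (2 * d + 2) * Real.exp (2 * M * ∑ i, |t i|) := by
  have hflow : ∀ i, IsBoundedFlow M (a i) (Φ i) := fun i => by
    have hbd : ∀ x, ‖a i x‖ ≤ M ∧ ‖fderiv ℝ (a i) x‖ ≤ M ∧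
        ‖fderiv ℝ (fderiv ℝ (a i)) x‖ ≤ M := fun x => by
      have h := haM i x
      rw [norm_iteratedFDeriv_one, ← norm_iteratedFDeriv_fderiv (n := 1),
        norm_iteratedFDeriv_one] at h
      have h0 := norm_nonneg (a i x)
      have h1 := norm_nonneg (fderiv ℝ (a i) x)
      have h2 := norm_nonneg (fderiv ℝ (fderiv ℝ (a i)) x)
      exact ⟨by linarith, by linarith, by linarith⟩
    exact ⟨ha i, fun x => (hbd x).1, fun x => (hbd x).2.1, fun x => (hbd x).2.2, hΦ0 i, hΦ i,
      hΦreg i⟩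
  obtain ⟨hH, hbound⟩ := contDiff_Hmap_and_norm_le (x₀ := x₀) hM1 hflow d le_rfl
  refine ⟨hH, fun t => ?_⟩
  obtain ⟨h1, h2⟩ := hbound t
  simp only [Fin.castLE_rfl, id] at h1 h2
  have hd2 : (d : ℝ) ≤ 2 ^ (d + 1) := by
    exact_mod_cast (Nat.lt_two_pow_self.le.trans (Nat.pow_le_pow_right two_pos d.le_succ))
  refine ⟨h1.trans (by gcongr), ?_⟩
  rw [← norm_iteratedFDeriv_fderiv (n := 1), norm_iteratedFDeriv_one]
  calc _ ≤ (d * Real.exp (M * ∑ i, |t i|)) ^ 2 := h2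
    _ ≤ (2 ^ (d + 1) * Real.exp (M * ∑ i, |t i|)) ^ 2 := by gcongr
    _ = _ := by
      rw [mul_pow, ← pow_mul, ← Real.exp_nat_mul]
      push_cast
      ring_nf
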